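/- arXiv:2305.03554 — 4 statements merged into one kernel-verified Lean document; each statement's English description precedes it below -/
import Mathlib

section
/- For the extended bicopter system, the fourth-order Lie derivatives of the outputs along the drift satisfy, for all χ ∈ ℝ⁸: L_F⁴H₁(χ) = −χ₆(2χ₈ cos χ₃ − χ₆χ₇ sin χ₃)/m and L_F⁴H₂(χ) = −χ₆(2χ₈ sin χ₃ + χ₆χ₇ cos χ₃)/m. -/
/- Extended bicopter system. Paper indices χ₁,…,χ₈ correspond to Lean indices 0,…,7. -/

/-- Drift vector field of the dynamically extended bicopter. -/
noncomputable def Fdrift (m g : ℝ) (χ : Fin 8 → ℝ) : Fin 8 → ℝ :=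
  ![χ 3, χ 4, χ 5, -Real.sin (χ 2) * χ 6 / m, -g + Real.cos (χ 2) * χ 6 / m, 0, χ 7, 0]

/-- Lie derivative of a scalar function along a vector field: L_X h(χ) = Dh(χ)·X(χ). -/
noncomputable def lieD (X : (Fin 8 → ℝ) → Fin 8 → ℝ) (h : (Fin 8 → ℝ) → ℝ)
    (χ : Fin 8 → ℝ) : ℝ :=
  fderiv ℝ h χ (X χ)

/-- Iterated Lie derivative along a vector field, with L_F^0 h = h. -/
noncomputable def lieIter (F : (Fin 8 → ℝ) → Fin 8 → ℝ) (h : (Fin 8 → ℝ) → ℝ) :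
    ℕ → (Fin 8 → ℝ) → ℝ
  | 0 => h
  | n + 1 => lieD F (lieIter F h n)

/-- Outputs H₁(χ) = χ₁ and H₂(χ) = χ₂. -/
def Hout (i : Fin 2) (χ : Fin 8 → ℝ) : ℝ := χ (Fin.castLE (by norm_num) i)

theorem lieD_eq_of_hasFDerivAt {X : (Fin 8 → ℝ) → Fin 8 → ℝ} {h : (Fin 8 → ℝ) → ℝ}
    {h' : (Fin 8 → ℝ) →L[ℝ] ℝ} {χ : Fin 8 → ℝ} (hh : HasFDerivAt h h' χ) :
    lieD X h χ = h' (X χ) := by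
  rw [lieD, hh.fderiv]

theorem lieD_apply (X : (Fin 8 → ℝ) → Fin 8 → ℝ) (i : Fin 8) :
    lieD X (fun χ => χ i) = fun χ => X χ i := by
  funext χ
  rw [lieD_eq_of_hasFDerivAt (hasFDerivAt_apply i χ)]
  rfl

/-- Second Lie derivatives of both outputs have the form `c + (a sin χ₃ + b cos χ₃) χ₇ / m`. -/
theorem lieD_Fdrift_acceleration (m g a b c : ℝ) :
    lieD (Fdrift m g)
        (fun χ => c + (a * Real.sin (χ 2) + b * Real.cos (χ 2)) * χ 6 / m) =
      fun χ => ((a * Real.cos (χ 2) - b * Real.sin (χ 2)) * (χ 5 * χ 6) +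
        (a * Real.sin (χ 2) + b * Real.cos (χ 2)) * χ 7) / m := by
  funext χ
  have hp (i : Fin 8) := hasFDerivAt_apply (𝕜 := ℝ) i χ
  refine (lieD_eq_of_hasFDerivAt
    ((((((hp 2).sin.const_mul a).add ((hp 2).cos.const_mul b)).mul (hp 6)).mul_const
      m⁻¹).const_add c)).trans ?_
  simp [Fdrift]
  ring

theorem lieD_Fdrift_jerk (m g a b : ℝ) :
    lieD (Fdrift m g)
        (fun χ => ((a * Real.cos (χ 2) - b * Real.sin (χ 2)) * (χ 5 * χ 6) +
          (a * Real.sin (χ 2) + b * Real.cos (χ 2)) * χ 7) / m) =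
      fun χ => χ 5 * (2 * χ 7 * (a * Real.cos (χ 2) - b * Real.sin (χ 2)) -
        χ 5 * χ 6 * (a * Real.sin (χ 2) + b * Real.cos (χ 2))) / m := by
  funext χ
  have hp (i : Fin 8) := hasFDerivAt_apply (𝕜 := ℝ) i χ
  refine (lieD_eq_of_hasFDerivAt
    ((((((hp 2).cos.const_mul a).sub ((hp 2).sin.const_mul b)).mul ((hp 5).mul (hp 6))).add
      ((((hp 2).sin.const_mul a).add ((hp 2).cos.const_mul b)).mul (hp 7))).mul_const m⁻¹)).trans ?_
  simp [Fdrift]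
  ring

theorem lieIter_four_of_acceleration {m g a b c : ℝ} {h : (Fin 8 → ℝ) → ℝ}
    (hh : lieIter (Fdrift m g) h 2 =
      fun χ => c + (a * Real.sin (χ 2) + b * Real.cos (χ 2)) * χ 6 / m) :
    lieIter (Fdrift m g) h 4 =
      fun χ => χ 5 * (2 * χ 7 * (a * Real.cos (χ 2) - b * Real.sin (χ 2)) -
        χ 5 * χ 6 * (a * Real.sin (χ 2) + b * Real.cos (χ 2))) / m := by
  rw [lieIter, lieIter, hh, lieD_Fdrift_acceleration, lieD_Fdrift_jerk]

theorem lieIter_two_Hout_zero (m g : ℝ) :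
    lieIter (Fdrift m g) (Hout 0) 2 =
      fun χ => 0 + (-1 * Real.sin (χ 2) + 0 * Real.cos (χ 2)) * χ 6 / m := by
  have h₁ : lieD (Fdrift m g) (Hout 0) = fun χ => χ 3 := lieD_apply _ 0
  rw [lieIter, lieIter, lieIter, h₁, lieD_apply]
  funext χ
  simp [Fdrift]

theorem lieIter_two_Hout_one (m g : ℝ) :
    lieIter (Fdrift m g) (Hout 1) 2 =
      fun χ => -g + (0 * Real.sin (χ 2) + 1 * Real.cos (χ 2)) * χ 6 / m := by
  have h₁ : lieD (Fdrift m g) (Hout 1) = fun χ => χ 4 := lieD_apply _ 1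
  rw [lieIter, lieIter, lieIter, h₁, lieD_apply]
  funext χ
  simp [Fdrift]

/-- For the extended bicopter system, the fourth-order Lie derivatives of the outputs along
the drift satisfy L_F⁴H₁(χ) = −χ₆(2χ₈ cos χ₃ − χ₆χ₇ sin χ₃)/m and
L_F⁴H₂(χ) = −χ₆(2χ₈ sin χ₃ + χ₆χ₇ cos χ₃)/m. -/
theorem extended_bicopter_fourth_lie_derivative
    (m J g : ℝ) (hm : 0 < m) (hJ : 0 < J) (χ : Fin 8 → ℝ) :
    lieIter (Fdrift m g) (Hout 0) 4 χ =
      -(χ 5) * (2 * χ 7 * Real.cos (χ 2) - χ 5 * χ 6 * Real.sin (χ 2)) / m ∧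
    lieIter (Fdrift m g) (Hout 1) 4 χ =
      -(χ 5) * (2 * χ 7 * Real.sin (χ 2) + χ 5 * χ 6 * Real.cos (χ 2)) / m := by
  rw [lieIter_four_of_acceleration (lieIter_two_Hout_zero m g),
    lieIter_four_of_acceleration (lieIter_two_Hout_one m g)]
  constructor <;> ring
end

section
/- Let m > 0 and g ∈ ℝ, and let T : ℝ⁸ → ℝ⁸ be the coordinate map T(χ) = (χ₁, χ₄, −(sin χ₃)χ₇/m, −((cos χ₃)χ₇χ₆ + (sin χ₃)χ₈)/m, χ₂, χ₅, −g + (cos χ₃)χ₇/m, (−(sin χ₃)χ₇χ₆ + (cos χ₃)χ₈)/m). Then the Fréchet derivative DT(χ) is an invertible linear map of ℝ⁸ if and only if χ₇ ≠ 0; in fact |det DT(χ)| = χ₇²/m⁴. -/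
/- Paper indices χ₁,…,χ₈ correspond to Lean indices 0,…,7. -/

/-- Coordinate map T stacking the outputs and their iterated Lie derivatives of orders 1–3. -/
noncomputable def Tmap (m g : ℝ) (χ : Fin 8 → ℝ) : Fin 8 → ℝ :=
  ![χ 0, χ 3, -Real.sin (χ 2) * χ 6 / m,
    -(Real.cos (χ 2) * χ 6 * χ 5 + Real.sin (χ 2) * χ 7) / m,
    χ 1, χ 4, -g + Real.cos (χ 2) * χ 6 / m,
    (-Real.sin (χ 2) * χ 6 * χ 5 + Real.cos (χ 2) * χ 7) / m]

/-- The Jacobian matrix of `Tmap m g` at `χ`. -/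
noncomputable def jacobianTmap (m : ℝ) (χ : Fin 8 → ℝ) : Matrix (Fin 8) (Fin 8) ℝ :=
  !![1, 0, 0, 0, 0, 0, 0, 0;
    0, 0, 0, 1, 0, 0, 0, 0;
    0, 0, -Real.cos (χ 2) * χ 6 / m, 0, 0, 0, -Real.sin (χ 2) / m, 0;
    0, 0, (Real.sin (χ 2) * χ 6 * χ 5 - Real.cos (χ 2) * χ 7) / m, 0, 0,
      -Real.cos (χ 2) * χ 6 / m, -Real.cos (χ 2) * χ 5 / m, -Real.sin (χ 2) / m;
    0, 1, 0, 0, 0, 0, 0, 0;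
    0, 0, 0, 0, 1, 0, 0, 0;
    0, 0, -Real.sin (χ 2) * χ 6 / m, 0, 0, 0, Real.cos (χ 2) / m, 0;
    0, 0, (-Real.cos (χ 2) * χ 6 * χ 5 - Real.sin (χ 2) * χ 7) / m, 0, 0,
      -Real.sin (χ 2) * χ 6 / m, -Real.sin (χ 2) * χ 5 / m, Real.cos (χ 2) / m]

theorem hasFDerivAt_Tmap (m g : ℝ) (χ : Fin 8 → ℝ) :
    HasFDerivAt (Tmap m g) (Matrix.toLin' (jacobianTmap m χ)).toContinuousLinearMap χ := by
  have hproj (i : Fin 8) : HasFDerivAt (fun x : Fin 8 → ℝ => x i)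
      (ContinuousLinearMap.proj (R := ℝ) (φ := fun _ : Fin 8 => ℝ) i) χ :=
    hasFDerivAt_apply i χ
  have hsin := (hproj 2).sin
  have hcos := (hproj 2).cos
  rw [hasFDerivAt_pi']
  intro i
  fin_cases i
  · refine (hproj 0).congr_fderiv ?_
    ext v
    simp [jacobianTmap, dotProduct, Fin.sum_univ_succ]
  · refine (hproj 3).congr_fderiv ?_
    ext v
    simp [jacobianTmap, dotProduct, Fin.sum_univ_eight]
  · refine ((hsin.neg.mul (hproj 6)).mul_const m⁻¹).congr_fderiv ?_
    ext v
    simp [jacobianTmap, dotProduct, Fin.sum_univ_eight]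
    ring
  · refine ((((hcos.mul (hproj 6)).mul (hproj 5)).add
      (hsin.mul (hproj 7))).neg.mul_const m⁻¹).congr_fderiv ?_
    ext v
    simp [jacobianTmap, dotProduct, Fin.sum_univ_eight]
    ring
  · refine (hproj 1).congr_fderiv ?_
    ext v
    simp [jacobianTmap, dotProduct, Fin.sum_univ_eight]
  · refine (hproj 4).congr_fderiv ?_
    ext v
    simp [jacobianTmap, dotProduct, Fin.sum_univ_eight]
  · refine (((hcos.mul (hproj 6)).mul_const m⁻¹).const_add (-g)).congr_fderiv ?_
    ext v
    simp [jacobianTmap, dotProduct, Fin.sum_univ_eight]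
    ring
  · refine ((((hsin.neg.mul (hproj 6)).mul (hproj 5)).add
      (hcos.mul (hproj 7))).mul_const m⁻¹).congr_fderiv ?_
    ext v
    simp [jacobianTmap, dotProduct, Fin.sum_univ_eight]
    ring

/-- After permuting rows and columns the Jacobian matrix is block lower triangular, with diagonal
blocks `1` and two `2 × 2` blocks. -/
theorem abs_det_jacobianTmap (m : ℝ) (χ : Fin 8 → ℝ) :
    |(jacobianTmap m χ).det| = χ 6 ^ 2 / m ^ 4 := by
  let rows : Fin 4 ⊕ (Fin 2 ⊕ Fin 2) ≃ Fin 8 :=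
    Equiv.ofBijective (Sum.elim ![0, 4, 1, 5] (Sum.elim ![2, 6] ![3, 7])) (by decide)
  let cols : Fin 4 ⊕ (Fin 2 ⊕ Fin 2) ≃ Fin 8 :=
    Equiv.ofBijective (Sum.elim ![0, 1, 3, 4] (Sum.elim ![2, 6] ![5, 7])) (by decide)
  let s := Real.sin (χ 2)
  let c := Real.cos (χ 2)
  have hblocks : (jacobianTmap m χ).submatrix rows cols =
      Matrix.fromBlocks 1 0 0 (Matrix.fromBlocks
        !![-c * χ 6 / m, -s / m; -s * χ 6 / m, c / m] 0
        !![(s * χ 6 * χ 5 - c * χ 7) / m, -c * χ 5 / m;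
          (-c * χ 6 * χ 5 - s * χ 7) / m, -s * χ 5 / m]
        !![-c * χ 6 / m, -s / m; -s * χ 6 / m, c / m]) := by
    ext i j
    rcases i with i | i | i <;> rcases j with j | j | j <;> fin_cases i <;> fin_cases j <;> rfl
  have hblock : (!![-c * χ 6 / m, -s / m; -s * χ 6 / m, c / m]).det = -(χ 6 / m ^ 2) := by
    rw [Matrix.det_fin_two_of]
    linear_combination (-(χ 6 / m ^ 2)) * Real.sin_sq_add_cos_sq (χ 2)
  rw [← Matrix.abs_det_submatrix_equiv_equiv rows cols, hblocks, Matrix.det_fromBlocks_zero₂₁,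
    Matrix.det_fromBlocks_zero₁₂, hblock, Matrix.det_one, one_mul, abs_mul_self]
  ring

/-- The Fréchet derivative DT(χ) is an invertible linear map of ℝ⁸ iff χ₇ ≠ 0;
in fact |det DT(χ)| = χ₇²/m⁴. -/
theorem bicopter_coordinate_map_jacobian (m g : ℝ) (hm : 0 < m) (χ : Fin 8 → ℝ) :
    |LinearMap.det (fderiv ℝ (Tmap m g) χ).toLinearMap| = (χ 6) ^ 2 / m ^ 4 ∧
    (Function.Bijective (fderiv ℝ (Tmap m g) χ) ↔ χ 6 ≠ 0) := by
  have hdet : |LinearMap.det (fderiv ℝ (Tmap m g) χ).toLinearMap| = χ 6 ^ 2 / m ^ 4 := by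
    rw [(hasFDerivAt_Tmap m g χ).fderiv, ← abs_det_jacobianTmap, ← LinearMap.det_toLin']
    rfl
  refine ⟨hdet, ?_⟩
  have hbij : Function.Bijective (fderiv ℝ (Tmap m g) χ) ↔
      IsUnit (fderiv ℝ (Tmap m g) χ).toLinearMap :=
    (Module.End.isUnit_iff _).symm
  rw [hbij, LinearMap.isUnit_iff_isUnit_det, isUnit_iff_ne_zero, ← abs_ne_zero, hdet]
  simp [hm.ne']
end

section
/- Let m > 0, J > 0, g ∈ ℝ, and let χ ∈ ℝ⁸ with χ₇ ≠ 0. For any v ∈ ℝ², define w = −β(χ)⁻¹(α(χ) − v), where α(χ) = (−χ₆(2χ₈ cos χ₃ − χ₆χ₇ sin χ₃)/m, −χ₆(2χ₈ sin χ₃ + χ₆χ₇ cos χ₃)/m) and β(χ) = [[−(sin χ₃)/m, −(cos χ₃)χ₇/(mJ)], [(cos χ₃)/m, −(sin χ₃)χ₇/(mJ)]]. Then DT(χ)·(F(χ) + G(χ)w) = A_ξ T(χ) + B_ξ v, where T is the coordinate map, i.e., the feedback w exactly linearizes the extended bicopter system into two decoupled chains of four integrators. -/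
/-- Input matrix G with columns G₁ = e₈ and G₂ = (1/J)e₆. -/
noncomputable def Gmat (J : ℝ) : Matrix (Fin 8) (Fin 2) ℝ :=
  Matrix.of fun i j =>
    if i = 7 ∧ j = 0 then 1 else if i = 5 ∧ j = 1 then 1 / J else 0

/-- α(χ) from the input-output linearizing control law. -/
noncomputable def alphaVec (m : ℝ) (χ : Fin 8 → ℝ) : Fin 2 → ℝ :=
  ![-(χ 5) * (2 * χ 7 * Real.cos (χ 2) - χ 5 * χ 6 * Real.sin (χ 2)) / m,
    -(χ 5) * (2 * χ 7 * Real.sin (χ 2) + χ 5 * χ 6 * Real.cos (χ 2)) / m]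

/-- Decoupling matrix β(χ). -/
noncomputable def betaMat (m J : ℝ) (χ : Fin 8 → ℝ) : Matrix (Fin 2) (Fin 2) ℝ :=
  !![-Real.sin (χ 2) / m, -Real.cos (χ 2) * χ 6 / (m * J);
     Real.cos (χ 2) / m, -Real.sin (χ 2) * χ 6 / (m * J)]

/-- Brunovsky-form matrix A_ξ: two 4×4 blocks with ones on the superdiagonal. -/
def Axi : Matrix (Fin 8) (Fin 8) ℝ :=
  Matrix.of fun i j => if (j : ℕ) = (i : ℕ) + 1 ∧ (i : ℕ) ≠ 3 then 1 else 0

/-- Input matrix B_ξ with columns e₄ and e₈. -/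
def Bxi : Matrix (Fin 8) (Fin 2) ℝ :=
  Matrix.of fun i j => if (i = 3 ∧ j = 0) ∨ (i = 7 ∧ j = 1) then 1 else 0

theorem differentiable_Tmap (m g : ℝ) : Differentiable ℝ (Tmap m g) := by
  rw [differentiable_pi]
  intro i
  fin_cases i <;> simp [Tmap] <;> fun_prop

/-- Directional derivative of the coordinate map. -/
theorem fderiv_Tmap_apply (m g : ℝ) (χ u : Fin 8 → ℝ) :
    fderiv ℝ (Tmap m g) χ u =
      ![u 0, u 3,
        -(Real.cos (χ 2) * u 2 * χ 6 + Real.sin (χ 2) * u 6) / m,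
        -(-Real.sin (χ 2) * u 2 * χ 6 * χ 5 + Real.cos (χ 2) * u 6 * χ 5
          + Real.cos (χ 2) * χ 6 * u 5 + Real.cos (χ 2) * u 2 * χ 7 + Real.sin (χ 2) * u 7) / m,
        u 1, u 4,
        (-Real.sin (χ 2) * u 2 * χ 6 + Real.cos (χ 2) * u 6) / m,
        (-Real.cos (χ 2) * u 2 * χ 6 * χ 5 - Real.sin (χ 2) * u 6 * χ 5
          - Real.sin (χ 2) * χ 6 * u 5 - Real.sin (χ 2) * u 2 * χ 7
          + Real.cos (χ 2) * u 7) / m] := by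
  have line (i : Fin 8) : HasDerivAt (fun t : ℝ => χ i + t * u i) (u i) 0 := by
    simpa using ((hasDerivAt_id (0 : ℝ)).mul_const (u i)).const_add (χ i)
  have hsin := (line 2).sin
  have hcos := (line 2).cos
  rw [← (differentiable_Tmap m g χ).lineDeriv_eq_fderiv]
  refine HasDerivAt.deriv (hasDerivAt_pi.2 fun i => ?_)
  fin_cases i
  · simpa [Tmap] using line 0
  · simpa [Tmap] using line 3
  · refine HasDerivAt.congr_deriv ((hsin.neg.mul (line 6)).div_const m) ?_
    simp
    ring
  · refine HasDerivAt.congr_deriv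
      ((((hcos.mul (line 6)).mul (line 5)).add (hsin.mul (line 7))).neg.div_const m) ?_
    simp
    ring
  · simpa [Tmap] using line 1
  · simpa [Tmap] using line 4
  · refine HasDerivAt.congr_deriv (((hcos.mul (line 6)).div_const m).const_add (-g)) ?_
    simp
  · refine HasDerivAt.congr_deriv
      ((((hsin.neg.mul (line 6)).mul (line 5)).add (hcos.mul (line 7))).div_const m) ?_
    simp
    ring

theorem isUnit_det_betaMat {m J : ℝ} (hm : m ≠ 0) (hJ : J ≠ 0) {χ : Fin 8 → ℝ} (h7 : χ 6 ≠ 0) :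
    IsUnit (betaMat m J χ).det := by
  have hdet : (betaMat m J χ).det = χ 6 / (m ^ 2 * J) := by
    rw [betaMat, Matrix.det_fin_two_of]
    field_simp
    linear_combination Real.sin_sq_add_cos_sq (χ 2)
  rw [hdet, isUnit_iff_ne_zero]
  positivity

theorem Gmat_mulVec (J : ℝ) (w : Fin 2 → ℝ) :
    (Gmat J).mulVec w = ![0, 0, 0, 0, 0, w 1 / J, 0, w 0] := by
  ext i
  simp only [Gmat, Matrix.mulVec, dotProduct, Matrix.of_apply, Fin.sum_univ_two]
  fin_cases i <;> simp [div_eq_inv_mul]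

theorem Axi_mulVec (x : Fin 8 → ℝ) :
    Axi.mulVec x = ![x 1, x 2, x 3, 0, x 5, x 6, x 7, 0] := by
  ext i
  simp only [Axi, Matrix.mulVec, dotProduct, Matrix.of_apply, Fin.sum_univ_eight]
  fin_cases i <;> simp

theorem Bxi_mulVec (v : Fin 2 → ℝ) :
    Bxi.mulVec v = ![0, 0, 0, v 0, 0, 0, 0, v 1] := by
  ext i
  simp only [Bxi, Matrix.mulVec, dotProduct, Matrix.of_apply, Fin.sum_univ_two]
  fin_cases i <;> simp

/-- Along the controlled vector field the coordinates `Tmap` satisfy the integrator chains driven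
by `α + β w`. -/
theorem fderiv_Tmap_controlled (m J g : ℝ) (χ : Fin 8 → ℝ) (w : Fin 2 → ℝ) :
    fderiv ℝ (Tmap m g) χ (Fdrift m g χ + (Gmat J).mulVec w) =
      Axi.mulVec (Tmap m g χ) + Bxi.mulVec (alphaVec m χ + (betaMat m J χ).mulVec w) := by
  rw [fderiv_Tmap_apply, Gmat_mulVec, Axi_mulVec, Bxi_mulVec]
  ext i
  fin_cases i <;> simp [Fdrift, Tmap, alphaVec, betaMat, dotProduct] <;> ring

/-- The feedback w = −β(χ)⁻¹(α(χ) − v) exactly linearizes the extended bicopter system: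
DT(χ)·(F(χ) + G(χ)w) = A_ξ T(χ) + B_ξ v. -/
theorem bicopter_feedback_linearization (m J g : ℝ) (hm : 0 < m) (hJ : 0 < J)
    (χ : Fin 8 → ℝ) (h7 : χ 6 ≠ 0) (v : Fin 2 → ℝ) :
    fderiv ℝ (Tmap m g) χ
        (Fdrift m g χ + (Gmat J).mulVec (-(betaMat m J χ)⁻¹.mulVec (alphaVec m χ - v))) =
      Axi.mulVec (Tmap m g χ) + Bxi.mulVec v := by
  rw [fderiv_Tmap_controlled, Matrix.mulVec_neg, Matrix.mulVec_mulVec,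
    Matrix.mul_nonsing_inv _ (isUnit_det_betaMat hm.ne' hJ.ne' h7), Matrix.one_mulVec,
    neg_sub, add_sub_cancel]
end

section
/- Let m > 0, J > 0, g ∈ ℝ. Suppose χ : ℝ → ℝ⁸ is differentiable, v : ℝ → ℝ² is continuous, χ₇(t) ≠ 0 for all t, and χ satisfies the closed-loop extended bicopter dynamics χ̇(t) = F(χ(t)) + G(χ(t))w(t) with w(t) = −β(χ(t))⁻¹(α(χ(t)) − v(t)). Then for i = 1, 2, the output t ↦ χᵢ(t) is four times differentiable and its fourth derivative equals vᵢ(t) for all t. -/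
/-- The determinant of the decoupling matrix is `χ₇ / (m² J)`. -/
lemma betaMat_det (m J : ℝ) (χ : Fin 8 → ℝ) :
    (betaMat m J χ).det = χ 6 / (m * (m * J)) := by
  rw [betaMat, Matrix.det_fin_two_of]
  linear_combination (χ 6 / (m * (m * J))) * Real.sin_sq_add_cos_sq (χ 2)

/-- The linearizing feedback `w = -β⁻¹(α - v)` solves `β w = v - α`. -/
lemma betaMat_mulVec_feedback {m J : ℝ} (hm : m ≠ 0) (hJ : J ≠ 0) {χ : Fin 8 → ℝ}
    (hχ : χ 6 ≠ 0) (v : Fin 2 → ℝ) :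
    (betaMat m J χ).mulVec (-(betaMat m J χ)⁻¹.mulVec (alphaVec m χ - v)) =
      v - alphaVec m χ := by
  have hdet : IsUnit (betaMat m J χ).det := by
    rw [betaMat_det, isUnit_iff_ne_zero]
    positivity
  rw [Matrix.mulVec_neg, Matrix.mulVec_mulVec, Matrix.mul_nonsing_inv _ hdet,
    Matrix.one_mulVec, neg_sub]

/-- Along any solution of the closed-loop extended bicopter dynamics with the
input-output linearizing feedback w = −β(χ)⁻¹(α(χ) − v), each output t ↦ χᵢ(t) (i = 1, 2)
is four times differentiable and its fourth derivative equals vᵢ(t). -/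
theorem bicopter_closed_loop_output_fourth_derivative (m J g : ℝ) (hm : 0 < m) (hJ : 0 < J)
    (χ : ℝ → Fin 8 → ℝ) (v : ℝ → Fin 2 → ℝ) (hv : Continuous v)
    (h7 : ∀ t, χ t 6 ≠ 0)
    (hode : ∀ t, HasDerivAt χ
      (Fdrift m g (χ t) +
        (Gmat J).mulVec (-(betaMat m J (χ t))⁻¹.mulVec (alphaVec m (χ t) - v t))) t) :
    ∀ i : Fin 2, ∃ d1 d2 d3 : ℝ → ℝ,
      (∀ t, HasDerivAt (fun s => χ s (Fin.castLE (by norm_num) i)) (d1 t) t) ∧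
      (∀ t, HasDerivAt d1 (d2 t) t) ∧
      (∀ t, HasDerivAt d2 (d3 t) t) ∧
      (∀ t, HasDerivAt d3 (v t i) t) := by
  obtain ⟨w, hw⟩ : ∃ w : ℝ → Fin 2 → ℝ, ∀ t,
      w t = -(betaMat m J (χ t))⁻¹.mulVec (alphaVec m (χ t) - v t) := ⟨_, fun _ => rfl⟩
  have hβ : ∀ t, (betaMat m J (χ t)).mulVec (w t) = v t - alphaVec m (χ t) := fun t => by
    rw [hw]
    exact betaMat_mulVec_feedback hm.ne' hJ.ne' (h7 t) (v t)
  have hcoord : ∀ (k : Fin 8) t,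
      HasDerivAt (fun s => χ s k) ((Fdrift m g (χ t) + (Gmat J).mulVec (w t)) k) t :=
    fun k t => by
      rw [hw]
      exact hasDerivAt_pi.1 (hode t) k
  have h0 : ∀ t, HasDerivAt (fun s => χ s 0) (χ t 3) t := fun t => by
    simpa [Fdrift, Gmat, Matrix.mulVec, dotProduct] using hcoord 0 t
  have h1 : ∀ t, HasDerivAt (fun s => χ s 1) (χ t 4) t := fun t => by
    simpa [Fdrift, Gmat, Matrix.mulVec, dotProduct] using hcoord 1 t
  have h2 : ∀ t, HasDerivAt (fun s => χ s 2) (χ t 5) t := fun t => by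
    simpa [Fdrift, Gmat, Matrix.mulVec, dotProduct] using hcoord 2 t
  have h3 : ∀ t, HasDerivAt (fun s => χ s 3) (-Real.sin (χ t 2) * χ t 6 / m) t := fun t => by
    simpa [Fdrift, Gmat, Matrix.mulVec, dotProduct] using hcoord 3 t
  have h4 : ∀ t, HasDerivAt (fun s => χ s 4) (-g + Real.cos (χ t 2) * χ t 6 / m) t :=
    fun t => by simpa [Fdrift, Gmat, Matrix.mulVec, dotProduct] using hcoord 4 t
  have h5 : ∀ t, HasDerivAt (fun s => χ s 5) (w t 1 / J) t := fun t => by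
    simpa [Fdrift, Gmat, Matrix.mulVec, dotProduct, div_eq_inv_mul] using hcoord 5 t
  have h6 : ∀ t, HasDerivAt (fun s => χ s 6) (χ t 7) t := fun t => by
    simpa [Fdrift, Gmat, Matrix.mulVec, dotProduct] using hcoord 6 t
  have hχ7 : ∀ t, HasDerivAt (fun s => χ s 7) (w t 0) t := fun t => by
    simpa [Fdrift, Gmat, Matrix.mulVec, dotProduct] using hcoord 7 t
  rw [Fin.forall_fin_two]
  constructor
  · refine ⟨fun t => χ t 3, fun t => -Real.sin (χ t 2) * χ t 6 / m,
      fun t => (-(Real.cos (χ t 2) * χ t 5) * χ t 6 + -Real.sin (χ t 2) * χ t 7) / m,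
      h0, h3, fun t => ((h2 t).sin.fun_neg.fun_mul (h6 t)).div_const m, fun t => ?_⟩
    have hrow := congrFun (hβ t) 0
    simp [betaMat, alphaVec, Matrix.mulVec, dotProduct] at hrow
    refine (((((h2 t).cos.fun_mul (h5 t)).fun_neg.fun_mul (h6 t)).fun_add
      ((h2 t).sin.fun_neg.fun_mul (hχ7 t))).div_const m).congr_deriv ?_
    linear_combination hrow
  · refine ⟨fun t => χ t 4, fun t => -g + Real.cos (χ t 2) * χ t 6 / m,
      fun t => (-Real.sin (χ t 2) * χ t 5 * χ t 6 + Real.cos (χ t 2) * χ t 7) / m,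
      h1, h4, fun t => (((h2 t).cos.fun_mul (h6 t)).div_const m).const_add (-g), fun t => ?_⟩
    have hrow := congrFun (hβ t) 1
    simp [betaMat, alphaVec, Matrix.mulVec, dotProduct] at hrow
    refine (((((h2 t).sin.fun_neg.fun_mul (h5 t)).fun_mul (h6 t)).fun_add
      ((h2 t).cos.fun_mul (hχ7 t))).div_const m).congr_deriv ?_
    linear_combination hrow
end
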